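/- Let M be a Hilbert module of holomorphic functions on Ω with reproducing kernel K and associated sheaf S^M ⊆ O_Ω (the subsheaf generated by the global sections f ∈ M). For w₀ ∈ Ω, V_{w₀}(M) = V_{w₀}(S^M_{w₀}), i.e. a polynomial q satisfies q(D)f|_{w₀} = 0 for all f ∈ M if and only if q(D)h|_{w₀} = 0 for every germ h ∈ S^M_{w₀}. -/

import Mathlib

open MvPolynomial

/-- The Wirtinger partial derivative `∂f/∂z_i` of a function of `m` complex variables. -/
noncomputable def pderivFun {m : ℕ} (i : Fin m) (f : (Fin m → ℂ) → ℂ) : (Fin m → ℂ) → ℂ :=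
  fun z => fderiv ℂ f z (Pi.single i 1)

/-- The iterated derivative `∂^α f` for a multi-index `α`. -/
noncomputable def mderiv {m : ℕ} (α : Fin m → ℕ) (f : (Fin m → ℂ) → ℂ) : (Fin m → ℂ) → ℂ :=
  (List.finRange m).foldr (fun i g => (pderivFun i)^[α i] g) f

/-- The constant-coefficient differential operator `q(D) = Σ a_α ∂^α` associated to the
polynomial `q = Σ a_α z^α`. -/
noncomputable def applyDiff {m : ℕ} (q : MvPolynomial (Fin m) ℂ)
    (f : (Fin m → ℂ) → ℂ) : (Fin m → ℂ) → ℂ :=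
  fun z => ∑ α ∈ q.support, q.coeff α * mderiv (fun i => α i) f z

/-- The characteristic space at `w` of a set `F` of functions:
`V_w(F) = {q : q(D)f|_w = 0 for all f ∈ F}`. -/
def charSpace {m : ℕ} (w : Fin m → ℂ) (F : Set ((Fin m → ℂ) → ℂ)) :
    Set (MvPolynomial (Fin m) ℂ) :=
  {q | ∀ f ∈ F, applyDiff q f w = 0}

section Holomorphic

open Filter Topology Metric MeasureTheory

/-- Holomorphy of a function of several complex variables in a neighbourhood of a point. -/
def HoloAt {m : ℕ} (w : Fin m → ℂ) (f : (Fin m → ℂ) → ℂ) : Prop :=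
  ∀ᶠ z in 𝓝 w, DifferentiableAt ℂ f z

variable {m : ℕ} {w : Fin m → ℂ} {f g : (Fin m → ℂ) → ℂ}

/-- Cauchy's integral formula for a partial derivative. -/
lemma pderivFun_eq_circleIntegral {i : Fin m} {z : Fin m → ℂ} {r ρ : ℝ} (hr : 0 < r) (hρ : r < ρ)
    (hf : ∀ y ∈ ball z ρ, DifferentiableAt ℂ f y) :
    pderivFun i f z =
      (2 * Real.pi * Complex.I : ℂ)⁻¹ •
        ∮ t in C(0, r), ((t - 0) ^ 2)⁻¹ • f (z + t • Pi.single i (1 : ℂ)) := by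
  have hmem : ∀ t ∈ ball (0 : ℂ) ρ, z + t • Pi.single i (1 : ℂ) ∈ ball z ρ := by
    intro t ht
    simpa [norm_smul, Pi.norm_single] using ht
  have hd : DifferentiableOn ℂ (fun t : ℂ => f (z + t • Pi.single i (1 : ℂ))) (ball 0 ρ) := by
    intro t ht
    refine DifferentiableAt.differentiableWithinAt ?_
    exact (hf _ (hmem t ht)).fun_comp' t (by fun_prop)
  have := Complex.cderiv_eq_deriv (z := 0) isOpen_ball hd hr (closedBall_subset_ball hρ)
  rw [Complex.cderiv] at this
  rw [this]
  exact ((hf z (mem_ball_self (hr.trans hρ))).lineDeriv_eq_fderiv).symm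

lemma HoloAt.pderivFun (hf : HoloAt w f) (i : Fin m) : HoloAt w (pderivFun i f) := by
  obtain ⟨δ₁, hδ₁, hd⟩ := Metric.eventually_nhds_iff_ball.1 hf
  obtain ⟨δ₂, hδ₂, hb⟩ := Metric.continuousAt_iff.1 hf.self_of_nhds.continuousAt 1 one_pos
  obtain ⟨R, hR, h₁, h₂⟩ : ∃ R > 0, 4 * R ≤ δ₁ ∧ 4 * R ≤ δ₂ :=
    ⟨min δ₁ δ₂ / 4, by positivity, by linarith [min_le_left δ₁ δ₂], by linarith [min_le_right δ₁ δ₂]⟩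
  have hd' : ∀ y ∈ ball w (4 * R), DifferentiableAt ℂ f y :=
    fun y hy => hd y (ball_subset_ball h₁ hy)
  have hb' : ∀ y ∈ ball w (4 * R), dist (f y) (f w) < 1 :=
    fun y hy => hb (ball_subset_ball h₂ hy)
  have hfd : ∀ y ∈ ball w (3 * R), ‖fderiv ℂ f y‖ ≤ 2 / R := by
    intro y hy
    have hsub : ball y R ⊆ ball w (4 * R) := by
      refine ball_subset_ball' ?_
      rw [mem_ball] at hy
      linarith
    refine Complex.norm_fderiv_le_div_of_mapsTo_ball
      (fun x hx => (hd' x (hsub hx)).differentiableWithinAt) (fun x hx => ?_) hR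
    rw [mem_closedBall]
    have e₁ := hb' x (hsub hx)
    have e₂ := hb' y (hsub (mem_ball_self hR))
    linarith [dist_triangle_right (f x) (f y) (f w)]
  have hcm : ∀ z ∈ ball w R, ∀ θ : ℝ,
      z + circleMap 0 R θ • Pi.single i (1 : ℂ) ∈ ball w (3 * R) := by
    intro z hz θ
    rw [mem_ball, dist_eq_norm] at hz ⊢
    calc ‖z + circleMap 0 R θ • Pi.single i (1 : ℂ) - w‖
        = ‖(z - w) + circleMap 0 R θ • Pi.single i (1 : ℂ)‖ := by congr 1; abel
      _ ≤ ‖z - w‖ + ‖circleMap 0 R θ • Pi.single i (1 : ℂ)‖ := norm_add_le _ _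
      _ < 3 * R := by
        rw [norm_smul]
        simp [Pi.norm_single, abs_of_pos hR]
        linarith
  have h34 : ball w (3 * R) ⊆ ball w (4 * R) := ball_subset_ball (by linarith)
  have hderiv : Continuous fun θ : ℝ => deriv (circleMap 0 R) θ := by
    simp only [deriv_circleMap]
    fun_prop
  have hcoef : Continuous fun θ : ℝ => ((circleMap 0 R θ - 0) ^ 2)⁻¹ := by
    refine ((continuous_circleMap 0 R).sub continuous_const).pow 2 |>.inv₀ fun θ => ?_
    simp [circleMap, hR.ne']
  have hcont : ∀ z ∈ ball w R, Continuous fun θ : ℝ =>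
      deriv (circleMap 0 R) θ • ((circleMap 0 R θ - 0) ^ 2)⁻¹ •
        f (z + circleMap 0 R θ • Pi.single i (1 : ℂ)) := by
    intro z hz
    have h1 : Continuous fun θ : ℝ => f (z + circleMap 0 R θ • Pi.single i (1 : ℂ)) := by
      refine continuous_iff_continuousAt.2 fun θ => ?_
      exact ContinuousAt.comp (g := f)
        (hd' _ (h34 (hcm z hz θ))).continuousAt (by fun_prop)
    exact hderiv.smul (hcoef.smul h1)
  filter_upwards [ball_mem_nhds w hR] with z hz
  have key : _root_.pderivFun i f =ᶠ[𝓝 z] fun y => (2 * Real.pi * Complex.I : ℂ)⁻¹ •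
        ∮ t in C(0, R), ((t - 0) ^ 2)⁻¹ • f (y + t • Pi.single i (1 : ℂ)) := by
    filter_upwards [isOpen_ball.mem_nhds hz] with y hy
    refine pderivFun_eq_circleIntegral hR (ρ := 2 * R) (by linarith) fun x hx => hd' x ?_
    refine h34 (ball_subset_ball' ?_ hx)
    rw [mem_ball] at hy
    linarith
  refine DifferentiableAt.congr_of_eventuallyEq (DifferentiableAt.fun_const_smul ?_ _) key
  simp only [circleIntegral, intervalIntegral.integral_of_le Real.two_pi_pos.le]
  refine (hasFDerivAt_integral_of_dominated_of_fderiv_le (𝕜 := ℂ)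
    (μ := volume.restrict (Set.Ioc 0 (2 * Real.pi)))
    (F := fun y θ => deriv (circleMap 0 R) θ • ((circleMap 0 R θ - 0) ^ 2)⁻¹ •
        f (y + circleMap 0 R θ • Pi.single i (1 : ℂ)))
    (F' := fun y θ => deriv (circleMap 0 R) θ • ((circleMap 0 R θ - 0) ^ 2)⁻¹ •
        fderiv ℂ f (y + circleMap 0 R θ • Pi.single i (1 : ℂ)))
    (bound := fun _ => R * ((R ^ 2)⁻¹ * (2 / R)))
    (isOpen_ball.mem_nhds hz) ?_ ?_ ?_ ?_ ?_ ?_).differentiableAt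
  · filter_upwards [isOpen_ball.mem_nhds hz] with y hy
    exact (hcont y hy).aestronglyMeasurable
  · exact (hcont z hz).integrableOn_Ioc
  · refine Measurable.aestronglyMeasurable ?_
    have h1 : Measurable fun θ : ℝ => fderiv ℂ f (z + circleMap 0 R θ • Pi.single i (1 : ℂ)) :=
      (measurable_fderiv ℂ f).comp (by fun_prop : Continuous fun θ : ℝ =>
        z + circleMap 0 R θ • Pi.single i (1 : ℂ)).measurable
    exact hderiv.measurable.smul (hcoef.measurable.smul h1)
  · refine Eventually.of_forall fun θ y hy => ?_
    rw [norm_smul, norm_smul]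
    have e₁ : ‖deriv (circleMap 0 R) θ‖ = R := by simp [abs_of_pos hR]
    have e₂ : ‖((circleMap 0 R θ - 0) ^ 2)⁻¹‖ = (R ^ 2)⁻¹ := by simp
    rw [e₁, e₂]
    have := hfd _ (hcm y hy θ)
    gcongr
  · exact integrable_const _
  · refine Eventually.of_forall fun θ y hy => ?_
    refine HasFDerivAt.fun_const_smul (HasFDerivAt.fun_const_smul ?_ _) _
    have := (hd' _ (h34 (hcm y hy θ))).hasFDerivAt
    exact (hasFDerivAt_comp_add_right _).2 this

end Holomorphic

section Mderiv

open Filter Topology Metric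

variable {m : ℕ} {w : Fin m → ℂ} {f g : (Fin m → ℂ) → ℂ}

lemma HoloAt.add (hf : HoloAt w f) (hg : HoloAt w g) : HoloAt w (f + g) := by
  filter_upwards [hf, hg] with z h₁ h₂ using h₁.add h₂

lemma HoloAt.mul (hf : HoloAt w f) (hg : HoloAt w g) : HoloAt w (f * g) := by
  filter_upwards [hf, hg] with z h₁ h₂ using h₁.mul h₂

lemma HoloAt.const_smul (hf : HoloAt w f) (c : ℂ) : HoloAt w (c • f) := by
  filter_upwards [hf] with z h₁ using h₁.const_smul c

lemma HoloAt.sum {n : ℕ} {F : Fin n → (Fin m → ℂ) → ℂ} (hF : ∀ k, HoloAt w (F k)) :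
    HoloAt w (∑ k, F k) := by
  filter_upwards [eventually_all.2 hF] with z hz
  exact DifferentiableAt.sum fun k _ => hz k

lemma HoloAt.iterate_pderivFun (hf : HoloAt w f) (i : Fin m) (k : ℕ) :
    HoloAt w ((_root_.pderivFun i)^[k] f) := by
  induction k with
  | zero => exact hf
  | succ k ih => rw [Function.iterate_succ_apply']; exact ih.pderivFun i

lemma pderivFun_congr (h : f =ᶠ[𝓝 w] g) (i : Fin m) : pderivFun i f =ᶠ[𝓝 w] pderivFun i g :=
  h.fderiv.mono fun _ hz => congrArg (fun L : (Fin m → ℂ) →L[ℂ] ℂ => L (Pi.single i 1)) hz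

lemma iterate_pderivFun_congr (h : f =ᶠ[𝓝 w] g) (i : Fin m) (k : ℕ) :
    (pderivFun i)^[k] f =ᶠ[𝓝 w] (pderivFun i)^[k] g := by
  induction k with
  | zero => exact h
  | succ k ih => simp only [Function.iterate_succ_apply']; exact pderivFun_congr ih i

lemma pderivFun_add (hf : HoloAt w f) (hg : HoloAt w g) (i : Fin m) :
    pderivFun i (f + g) =ᶠ[𝓝 w] pderivFun i f + pderivFun i g := by
  filter_upwards [hf, hg] with z h₁ h₂
  simp [pderivFun, fderiv_add h₁ h₂]

lemma pderivFun_const_smul (hf : HoloAt w f) (c : ℂ) (i : Fin m) :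
    pderivFun i (c • f) =ᶠ[𝓝 w] c • pderivFun i f := by
  filter_upwards [hf] with z h₁
  simp [pderivFun, fderiv_const_smul h₁]

lemma pderivFun_mul (hf : HoloAt w f) (hg : HoloAt w g) (i : Fin m) :
    pderivFun i (f * g) =ᶠ[𝓝 w] pderivFun i f * g + f * pderivFun i g := by
  filter_upwards [hf, hg] with z h₁ h₂
  simp [pderivFun, fderiv_mul h₁ h₂]
  ring

lemma fderiv_eq_sum_pderivFun (f : (Fin m → ℂ) → ℂ) (z : Fin m → ℂ) :
    fderiv ℂ f z =
      ∑ i, pderivFun i f z • (ContinuousLinearMap.proj i : (Fin m → ℂ) →L[ℂ] ℂ) := by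
  ext v
  conv_lhs => rw [← Finset.univ_sum_single v]
  simp only [map_sum, pderivFun, sum_apply, smul_apply,
    ContinuousLinearMap.proj_apply, smul_eq_mul]
  refine Finset.sum_congr rfl fun i _ => ?_
  have : (Pi.single i (v i) : Fin m → ℂ) = v i • Pi.single i 1 := by
    rw [← Pi.single_smul, smul_eq_mul, mul_one]
  rw [this, map_smul, smul_eq_mul, mul_comm]

lemma pderivFun_comm (hf : HoloAt w f) (i j : Fin m) :
    pderivFun i (pderivFun j f) =ᶠ[𝓝 w] pderivFun j (pderivFun i f) := by
  have hd : ∀ᶠ z in 𝓝 w, ∀ k, DifferentiableAt ℂ (pderivFun k f) z :=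
    eventually_all.2 fun k => hf.pderivFun k
  filter_upwards [hd, eventually_eventually_nhds.2 hf] with z hz hz'
  have h₂ : DifferentiableAt ℂ (fderiv ℂ f) z := by
    rw [funext (fderiv_eq_sum_pderivFun f)]
    exact DifferentiableAt.fun_sum fun k _ => (hz k).smul_const _
  have happ : ∀ k l : Fin m, pderivFun k (pderivFun l f) z =
      fderiv ℂ (fderiv ℂ f) z (Pi.single k 1) (Pi.single l 1) := by
    intro k l
    have : pderivFun l f = fun y => fderiv ℂ f y (Pi.single l 1) := rfl
    rw [pderivFun, this, fderiv_clm_apply h₂ (differentiableAt_const _)]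
    simp
  rw [happ, happ]
  exact second_derivative_symmetric_of_eventually (hz'.mono fun y hy => hy.hasFDerivAt)
    h₂.hasFDerivAt _ _

lemma pderivFun_iterate_comm (hf : HoloAt w f) (i j : Fin m) (k : ℕ) :
    pderivFun i ((pderivFun j)^[k] f) =ᶠ[𝓝 w] (pderivFun j)^[k] (pderivFun i f) := by
  induction k with
  | zero => rfl
  | succ k ih =>
    simp only [Function.iterate_succ_apply']
    exact (pderivFun_comm (hf.iterate_pderivFun j k) i j).trans (pderivFun_congr ih j)

/-- The derivatives of orders `α i` in those variables `i` that occur in the list `l`. -/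
noncomputable def listDeriv (l : List (Fin m)) (α : Fin m → ℕ) (f : (Fin m → ℂ) → ℂ) :
    (Fin m → ℂ) → ℂ :=
  l.foldr (fun i g => (pderivFun i)^[α i] g) f

lemma listDeriv_cons (j : Fin m) (l : List (Fin m)) (α : Fin m → ℕ) (f : (Fin m → ℂ) → ℂ) :
    listDeriv (j :: l) α f = (pderivFun j)^[α j] (listDeriv l α f) :=
  rfl

lemma HoloAt.listDeriv (hf : HoloAt w f) (l : List (Fin m)) (α : Fin m → ℕ) :
    HoloAt w (listDeriv l α f) := by
  induction l with
  | nil => exact hf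
  | cons j l ih => exact ih.iterate_pderivFun j _

lemma listDeriv_congr (h : f =ᶠ[𝓝 w] g) (l : List (Fin m)) (α : Fin m → ℕ) :
    listDeriv l α f =ᶠ[𝓝 w] listDeriv l α g := by
  induction l with
  | nil => exact h
  | cons j l ih => exact iterate_pderivFun_congr ih j _

lemma listDeriv_add_single_of_notMem {i : Fin m} {l : List (Fin m)} (hi : i ∉ l) (α : Fin m → ℕ)
    (f : (Fin m → ℂ) → ℂ) : listDeriv l (α + Pi.single i 1) f = listDeriv l α f := by
  induction l with
  | nil => rfl
  | cons j l ih =>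
    rw [List.mem_cons, not_or] at hi
    simp [listDeriv_cons, ih hi.2, Ne.symm hi.1]

lemma listDeriv_pderivFun (hf : HoloAt w f) (i : Fin m) (l : List (Fin m)) (α : Fin m → ℕ) :
    pderivFun i (listDeriv l α f) =ᶠ[𝓝 w] listDeriv l α (pderivFun i f) := by
  induction l with
  | nil => rfl
  | cons j l ih =>
    exact (pderivFun_iterate_comm (hf.listDeriv l α) i j _).trans (iterate_pderivFun_congr ih j _)

lemma listDeriv_add_single {i : Fin m} {l : List (Fin m)} (hl : l.Nodup) (hi : i ∈ l)
    (α : Fin m → ℕ) (hf : HoloAt w f) :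
    listDeriv l (α + Pi.single i 1) f =ᶠ[𝓝 w] listDeriv l α (pderivFun i f) := by
  induction l with
  | nil => simp at hi
  | cons j l ih =>
    rw [List.nodup_cons] at hl
    by_cases hij : i = j
    · subst hij
      rw [listDeriv_cons, listDeriv_cons, listDeriv_add_single_of_notMem hl.1]
      simp only [Pi.add_apply, Pi.single_eq_same, Function.iterate_succ_apply]
      exact iterate_pderivFun_congr (listDeriv_pderivFun hf i l α) i _
    · have hil : i ∈ l := (List.mem_cons.1 hi).resolve_left hij
      rw [listDeriv_cons, listDeriv_cons, Pi.add_apply, Pi.single_eq_of_ne (Ne.symm hij), add_zero]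
      exact iterate_pderivFun_congr (ih hl.2 hil) j _

lemma mderiv_congr (h : f =ᶠ[𝓝 w] g) (α : Fin m → ℕ) : mderiv α f w = mderiv α g w :=
  (listDeriv_congr h (List.finRange m) α).self_of_nhds

lemma mderiv_add_single (hf : HoloAt w f) (α : Fin m → ℕ) (i : Fin m) :
    mderiv (α + Pi.single i 1) f w = mderiv α (pderivFun i f) w :=
  (listDeriv_add_single (List.nodup_finRange m) (List.mem_finRange i) α hf).self_of_nhds

lemma mderiv_zero (f : (Fin m → ℂ) → ℂ) : mderiv 0 f = f := by
  unfold mderiv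
  induction List.finRange m with
  | nil => rfl
  | cons j l ih => simp

lemma single_one_le_of_ne_zero {α : Fin m → ℕ} {i : Fin m} (hi : α i ≠ 0) :
    Pi.single i 1 ≤ α := by
  intro j
  obtain rfl | hj := eq_or_ne j i
  · rw [Pi.single_eq_same]
    exact Nat.one_le_iff_ne_zero.2 hi
  · simp [hj]

/-- Induction on multi-indices, one unit vector at a time. -/
lemma multiIndex_induction {P : (Fin m → ℕ) → Prop} (zero : P 0)
    (add_single : ∀ α i, P α → P (α + Pi.single i 1)) (α : Fin m → ℕ) : P α := by
  induction h : ∑ i, α i generalizing α with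
  | zero =>
    have : α = 0 := by
      funext i
      exact Finset.sum_eq_zero_iff.1 h i (Finset.mem_univ i)
    exact this ▸ zero
  | succ n ih =>
    obtain ⟨i, -, hi⟩ : ∃ i ∈ Finset.univ, α i ≠ 0 := Finset.exists_ne_zero_of_sum_ne_zero (by lia)
    have hle := single_one_le_of_ne_zero hi
    rw [← tsub_add_cancel_of_le hle]
    refine add_single _ _ (ih _ ?_)
    have hs := congrArg (fun β : Fin m → ℕ => ∑ k, β k) (tsub_add_cancel_of_le hle)
    simp only [Pi.add_apply, Finset.sum_add_distrib, Finset.sum_pi_single', Finset.mem_univ,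
      if_true] at hs
    lia

lemma mderiv_add (hf : HoloAt w f) (hg : HoloAt w g) (α : Fin m → ℕ) :
    mderiv α (f + g) w = mderiv α f w + mderiv α g w := by
  induction α using multiIndex_induction generalizing f g with
  | zero => simp [mderiv_zero]
  | add_single α i ih =>
    rw [mderiv_add_single hf, mderiv_add_single hg, mderiv_add_single (hf.add hg),
      mderiv_congr (pderivFun_add hf hg i), ih (hf.pderivFun i) (hg.pderivFun i)]

lemma mderiv_const_smul (hf : HoloAt w f) (c : ℂ) (α : Fin m → ℕ) :
    mderiv α (c • f) w = c * mderiv α f w := by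
  induction α using multiIndex_induction generalizing f with
  | zero => simp [mderiv_zero]
  | add_single α i ih =>
    rw [mderiv_add_single hf, mderiv_add_single (hf.const_smul c),
      mderiv_congr (pderivFun_const_smul hf c i), ih (hf.pderivFun i)]

/-- The function `z ↦ (z - w) ^ β`. -/
def monomialAt (w : Fin m → ℂ) (β : Fin m → ℕ) : (Fin m → ℂ) → ℂ :=
  fun z => ∏ j, (z j - w j) ^ β j

lemma holoAt_monomialAt (w : Fin m → ℂ) (β : Fin m → ℕ) : HoloAt w (monomialAt w β) := by
  refine Eventually.of_forall fun z => ?_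
  unfold monomialAt
  fun_prop

lemma pderivFun_monomialAt (w : Fin m → ℂ) (β : Fin m → ℕ) (i : Fin m) :
    pderivFun i (monomialAt w β) = (β i : ℂ) • monomialAt w (β - Pi.single i 1) := by
  funext z
  have hd : DifferentiableAt ℂ (monomialAt w β) z := by
    unfold monomialAt
    fun_prop
  rw [pderivFun, ← hd.lineDeriv_eq_fderiv, lineDeriv]
  have hfun : (fun t : ℂ => monomialAt w β (z + t • Pi.single i 1)) = fun t =>
      (t + (z i - w i)) ^ β i * ∏ j ∈ Finset.univ.erase i, (z j - w j) ^ β j := by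
    funext t
    rw [monomialAt, ← Finset.mul_prod_erase _ _ (Finset.mem_univ i)]
    congr 1
    · simp only [Pi.add_apply, Pi.smul_apply, Pi.single_eq_same, smul_eq_mul, mul_one]
      congr 1
      ring
    · refine Finset.prod_congr rfl fun j hj => ?_
      simp [Finset.ne_of_mem_erase hj]
  have hder : HasDerivAt (fun t : ℂ => (t + (z i - w i)) ^ β i)
      (β i * (0 + (z i - w i)) ^ (β i - 1) * 1) 0 :=
    ((hasDerivAt_id (0 : ℂ)).add_const (z i - w i)).pow (β i)
  rw [hfun, (hder.mul_const _).deriv, Pi.smul_apply, monomialAt, smul_eq_mul,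
    ← Finset.mul_prod_erase _ _ (Finset.mem_univ i)]
  have : ∏ j ∈ Finset.univ.erase i, (z j - w j) ^ (β - Pi.single i 1 : Fin m → ℕ) j =
      ∏ j ∈ Finset.univ.erase i, (z j - w j) ^ β j :=
    Finset.prod_congr rfl fun j hj => by simp [Finset.ne_of_mem_erase hj]
  rw [this]
  simp
  ring

lemma mderiv_monomialAt_ne_zero_iff (w : Fin m → ℂ) (α β : Fin m → ℕ) :
    mderiv α (monomialAt w β) w ≠ 0 ↔ α = β := by
  induction α using multiIndex_induction generalizing β with
  | zero =>
    rw [mderiv_zero, monomialAt, Finset.prod_ne_zero_iff]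
    simp [funext_iff, eq_comm, zero_pow_eq]
  | add_single α i ih =>
    rw [mderiv_add_single (holoAt_monomialAt w β), pderivFun_monomialAt,
      mderiv_const_smul (holoAt_monomialAt w _), mul_ne_zero_iff, ih, Nat.cast_ne_zero]
    constructor
    · rintro ⟨h, rfl⟩
      exact tsub_add_cancel_of_le (single_one_le_of_ne_zero h)
    · rintro rfl
      simp

end Mderiv

section Functional

open Filter Topology

variable {m : ℕ} {w : Fin m → ℂ} {f g : (Fin m → ℂ) → ℂ}

/-- On functions holomorphic near `w`, the functional `L` is a finite linear combination of
derivatives at `w`. -/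
def IsFiniteOrderAt (w : Fin m → ℂ) (L : ((Fin m → ℂ) → ℂ) → ℂ) : Prop :=
  ∃ c : (Fin m → ℕ) →₀ ℂ, ∀ g, HoloAt w g → L g = c.sum fun β a => a * mderiv β g w

lemma IsFiniteOrderAt.add {L₁ L₂ : ((Fin m → ℂ) → ℂ) → ℂ} (h₁ : IsFiniteOrderAt w L₁)
    (h₂ : IsFiniteOrderAt w L₂) : IsFiniteOrderAt w (fun g => L₁ g + L₂ g) := by
  obtain ⟨c₁, hc₁⟩ := h₁
  obtain ⟨c₂, hc₂⟩ := h₂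
  refine ⟨c₁ + c₂, fun g hg => ?_⟩
  beta_reduce
  rw [Finsupp.sum_add_index' (by simp) (by intros; ring), hc₁ g hg, hc₂ g hg]

lemma IsFiniteOrderAt.const_mul {L : ((Fin m → ℂ) → ℂ) → ℂ} (h : IsFiniteOrderAt w L) (a : ℂ) :
    IsFiniteOrderAt w (fun g => a * L g) := by
  obtain ⟨c, hc⟩ := h
  refine ⟨a • c, fun g hg => ?_⟩
  beta_reduce
  rw [Finsupp.sum_smul_index (by simp), hc g hg, Finsupp.mul_sum]
  simp only [mul_assoc]

lemma IsFiniteOrderAt.sum {ι : Type*} (s : Finset ι) {L : ι → ((Fin m → ℂ) → ℂ) → ℂ}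
    (h : ∀ k ∈ s, IsFiniteOrderAt w (L k)) : IsFiniteOrderAt w (fun g => ∑ k ∈ s, L k g) := by
  classical
  induction s using Finset.induction_on with
  | empty => exact ⟨0, by simp⟩
  | insert k s hk ih =>
    simp only [Finset.sum_insert hk]
    exact (h k (Finset.mem_insert_self k s)).add
      (ih fun j hj => h j (Finset.mem_insert_of_mem hj))

lemma IsFiniteOrderAt.comp_pderivFun {L : ((Fin m → ℂ) → ℂ) → ℂ} (h : IsFiniteOrderAt w L)
    (i : Fin m) : IsFiniteOrderAt w (fun g => L (pderivFun i g)) := by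
  obtain ⟨c, hc⟩ := h
  refine ⟨c.mapDomain (· + Pi.single i 1), fun g hg => ?_⟩
  beta_reduce
  rw [hc _ (hg.pderivFun i), Finsupp.sum_mapDomain_index (by simp) (by intros; ring)]
  simp only [mderiv_add_single hg]

lemma IsFiniteOrderAt.congr {L₁ L₂ : ((Fin m → ℂ) → ℂ) → ℂ} (h : IsFiniteOrderAt w L₁)
    (he : ∀ g, HoloAt w g → L₂ g = L₁ g) : IsFiniteOrderAt w L₂ := by
  obtain ⟨c, hc⟩ := h
  exact ⟨c, fun g hg => (he g hg).trans (hc g hg)⟩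

lemma isFiniteOrderAt_mderiv_mul (hf : HoloAt w f) (α : Fin m → ℕ) :
    IsFiniteOrderAt w (fun g => mderiv α (f * g) w) := by
  induction α using multiIndex_induction generalizing f with
  | zero => exact ⟨Finsupp.single 0 (f w), fun g _ => by simp [mderiv_zero]⟩
  | add_single α i ih =>
    refine ((ih (hf.pderivFun i)).add ((ih hf).comp_pderivFun i)).congr fun g hg => ?_
    rw [mderiv_add_single (hf.mul hg), mderiv_congr (pderivFun_mul hf hg i),
      mderiv_add ((hf.pderivFun i).mul hg) (hf.mul (hg.pderivFun i))]

lemma isFiniteOrderAt_applyDiff_mul (hf : HoloAt w f) (q : MvPolynomial (Fin m) ℂ) :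
    IsFiniteOrderAt w (fun g => applyDiff q (f * g) w) :=
  IsFiniteOrderAt.sum _ fun α _ => (isFiniteOrderAt_mderiv_mul hf fun i => α i).const_mul _

/-- A finite-order functional that kills all monomials centred at `w` kills every function
holomorphic near `w`. -/
lemma IsFiniteOrderAt.eq_zero {L : ((Fin m → ℂ) → ℂ) → ℂ} (h : IsFiniteOrderAt w L)
    (hL : ∀ β, L (monomialAt w β) = 0) (hg : HoloAt w g) : L g = 0 := by
  obtain ⟨c, hc⟩ := h
  have hzero : c = 0 := by
    ext β
    have h₁ := (hc _ (holoAt_monomialAt w β)).symm.trans (hL β)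
    rw [Finsupp.sum, Finset.sum_eq_single β] at h₁
    · exact (mul_eq_zero.1 h₁).resolve_right ((mderiv_monomialAt_ne_zero_iff w β β).2 rfl)
    · intro α _ hα
      rw [not_not.1 (mt (mderiv_monomialAt_ne_zero_iff w α β).1 hα), mul_zero]
    · intro hβ
      rw [Finsupp.notMem_support_iff.1 hβ, zero_mul]
  rw [hc g hg, hzero, Finsupp.sum_zero_index]

lemma applyDiff_congr (h : f =ᶠ[𝓝 w] g) (q : MvPolynomial (Fin m) ℂ) :
    applyDiff q f w = applyDiff q g w := by
  simp only [applyDiff, mderiv_congr h]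

lemma applyDiff_add (hf : HoloAt w f) (hg : HoloAt w g) (q : MvPolynomial (Fin m) ℂ) :
    applyDiff q (f + g) w = applyDiff q f w + applyDiff q g w := by
  simp only [applyDiff, mderiv_add hf hg, mul_add, Finset.sum_add_distrib]

lemma applyDiff_zero (q : MvPolynomial (Fin m) ℂ) : applyDiff q 0 w = 0 := by
  have h0 : HoloAt w 0 := Eventually.of_forall fun z => differentiableAt_const (0 : ℂ)
  simpa using applyDiff_add h0 h0 q

lemma applyDiff_sum_eq_zero {n : ℕ} {F : Fin n → (Fin m → ℂ) → ℂ} {q : MvPolynomial (Fin m) ℂ}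
    (hF : ∀ k, HoloAt w (F k)) (h : ∀ k, applyDiff q (F k) w = 0) :
    applyDiff q (∑ k, F k) w = 0 := by
  induction n with
  | zero => simpa using applyDiff_zero q
  | succ n ih =>
    rw [Fin.sum_univ_succ, applyDiff_add (hF 0) (HoloAt.sum fun k => hF k.succ), h 0,
      ih (fun k => hF k.succ) fun k => h k.succ, add_zero]

end Functional

/-- Let `𝓜` be a Hilbert module of holomorphic functions on `Ω` and
`S^𝓜_{w₀}` the stalk at `w₀` of the subsheaf of `O_Ω` generated by the elements of
`𝓜`, i.e. the set of functions of the form `Σᵢ fᵢ gᵢ` near `w₀` with `fᵢ ∈ 𝓜` and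
`gᵢ` holomorphic near `w₀`.  Then `V_{w₀}(𝓜) = V_{w₀}(S^𝓜_{w₀})`. -/
theorem stmt16 {m : ℕ} (Ω : Set ((Fin m) → ℂ)) (hΩopen : IsOpen Ω)
    (hΩbdd : Bornology.IsBounded Ω)
    (𝓜 : Type*) [NormedAddCommGroup 𝓜] [InnerProductSpace ℂ 𝓜] [CompleteSpace 𝓜]
    -- realization of 𝓜 as a space of holomorphic functions on Ω
    (ev : 𝓜 →ₗ[ℂ] ((Fin m → ℂ) → ℂ))
    (hev_inj : Function.Injective ev)
    (hhol : ∀ f : 𝓜, DifferentiableOn ℂ (ev f) Ω)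
    -- 𝓜 is a module over the polynomials
    (M : MvPolynomial (Fin m) ℂ → 𝓜 →L[ℂ] 𝓜)
    (hM : ∀ q f z, z ∈ Ω → ev (M q f) z = MvPolynomial.eval z q * ev f z)
    (w₀ : Fin m → ℂ) (hw₀ : w₀ ∈ Ω) :
    charSpace w₀ (Set.range fun f : 𝓜 => ev f) =
      charSpace w₀
        {h : (Fin m → ℂ) → ℂ |
          ∃ (U : Set (Fin m → ℂ)), IsOpen U ∧ w₀ ∈ U ∧ U ⊆ Ω ∧
            ∃ (n : ℕ) (f : Fin n → 𝓜) (g : Fin n → ((Fin m → ℂ) → ℂ)),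
              (∀ i, DifferentiableOn ℂ (g i) U) ∧
              ∀ z ∈ U, h z = ∑ i, ev (f i) z * g i z} := by
  have holo_of_isOpen : ∀ {U : Set (Fin m → ℂ)} {g : (Fin m → ℂ) → ℂ}, IsOpen U → w₀ ∈ U →
      DifferentiableOn ℂ g U → HoloAt w₀ g := fun hU hw hg =>
    Filter.mem_of_superset (hU.mem_nhds hw) fun z hz => hg.differentiableAt (hU.mem_nhds hz)
  ext q
  constructor
  · rintro hq h ⟨U, hU, hwU, hUΩ, n, f, g, hg, hh⟩
    have hf : ∀ i, HoloAt w₀ (ev (f i)) := fun i => holo_of_isOpen hΩopen hw₀ (hhol (f i))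
    have hg' : ∀ i, HoloAt w₀ (g i) := fun i => holo_of_isOpen hU hwU (hg i)
    have hsum : h =ᶠ[nhds w₀] ∑ i, ev (f i) * g i :=
      Filter.mem_of_superset (hU.mem_nhds hwU) fun z hz => by simp [hh z hz]
    rw [applyDiff_congr hsum]
    refine applyDiff_sum_eq_zero (fun i => (hf i).mul (hg' i)) fun i => ?_
    refine (isFiniteOrderAt_applyDiff_mul (hf i) q).eq_zero (fun β => ?_) (hg' i)
    have hmul : ev (f i) * monomialAt w₀ β =ᶠ[nhds w₀]
        ev (M (∏ j, (X j - C (w₀ j)) ^ β j) (f i)) := by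
      refine Filter.mem_of_superset (hΩopen.mem_nhds hw₀) fun z hz => ?_
      simp [hM _ _ z hz, monomialAt, mul_comm]
    rw [applyDiff_congr hmul]
    exact hq _ ⟨_, rfl⟩
  · rintro hq _ ⟨f, rfl⟩
    exact hq _ ⟨Ω, hΩopen, hw₀, subset_rfl, 1, fun _ => f, fun _ _ => 1,
      fun _ => differentiableOn_const 1, fun z _ => by simp⟩
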